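/- Suppose p satisfies Y ⊥ A | (Z,C). Then Var_p(φ_bdtd) ≤ Var_p(φ_td) and Var_p(φ_bdtd) ≤ Var_p(φ_bd). -/

import Mathlib

open Finset

noncomputable section

namespace TwoDoorPaper

/-- Indicator 1[a = b] as a real number. -/
def ind {A : Type*} [DecidableEq A] (a b : A) : ℝ := if a = b then 1 else 0

variable {C A Z Y : Type*} [Fintype C] [Fintype A] [Fintype Z] [Fintype Y]

/-- Marginal p(c). -/
def pC (p : C → A → Z → Y → ℝ) (c : C) : ℝ := ∑ a, ∑ z, ∑ y, p c a z y

/-- Marginal p(a,c). -/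
def pAC (p : C → A → Z → Y → ℝ) (a : A) (c : C) : ℝ := ∑ z, ∑ y, p c a z y

/-- Marginal p(c,a,z). -/
def pCAZ (p : C → A → Z → Y → ℝ) (c : C) (a : A) (z : Z) : ℝ := ∑ y, p c a z y

/-- Marginal p(a). -/
def pA (p : C → A → Z → Y → ℝ) (a : A) : ℝ := ∑ c, pAC p a c

/-- Marginal p(a,z). -/
def pAZ (p : C → A → Z → Y → ℝ) (a : A) (z : Z) : ℝ := ∑ c, pCAZ p c a z

/-- Marginal p(z,c). -/
def pZC (p : C → A → Z → Y → ℝ) (z : Z) (c : C) : ℝ := ∑ a, pCAZ p c a z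

/-- Conditional p(a|c). -/
def cA (p : C → A → Z → Y → ℝ) (a : A) (c : C) : ℝ := pAC p a c / pC p c

/-- Conditional p(z|a,c). -/
def cZ (p : C → A → Z → Y → ℝ) (z : Z) (a : A) (c : C) : ℝ := pCAZ p c a z / pAC p a c

/-- Conditional p(z|a). -/
def cZA (p : C → A → Z → Y → ℝ) (z : Z) (a : A) : ℝ := pAZ p a z / pA p a

/-- Conditional p(y|a,z,c). -/
def cY (p : C → A → Z → Y → ℝ) (a : A) (z : Z) (c : C) (y : Y) : ℝ := p c a z y / pCAZ p c a z

/-- Conditional p(y|a,z). -/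
def cYaz (p : C → A → Z → Y → ℝ) (a : A) (z : Z) (y : Y) : ℝ := (∑ c, p c a z y) / pAZ p a z

/-- Conditional p(y|a,c). -/
def cYac (p : C → A → Z → Y → ℝ) (a : A) (c : C) (y : Y) : ℝ := (∑ z, p c a z y) / pAC p a c

/-- Conditional p(y|z,c). -/
def cYzc (p : C → A → Z → Y → ℝ) (z : Z) (c : C) (y : Y) : ℝ := (∑ a, p c a z y) / pZC p z c

/-- Conditional expectation E(Y|a,z,c). -/
def EYazc (p : C → A → Z → Y → ℝ) (yv : Y → ℝ) (a : A) (z : Z) (c : C) : ℝ :=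
  ∑ y, yv y * cY p a z c y

/-- Conditional variance var(Y|a,z,c). -/
def VYazc (p : C → A → Z → Y → ℝ) (yv : Y → ℝ) (a : A) (z : Z) (c : C) : ℝ :=
  (∑ y, (yv y) ^ 2 * cY p a z c y) - (EYazc p yv a z c) ^ 2

/-- Conditional expectation E(Y|a,z). -/
def EYaz (p : C → A → Z → Y → ℝ) (yv : Y → ℝ) (a : A) (z : Z) : ℝ :=
  ∑ y, yv y * cYaz p a z y

/-- Conditional variance var(Y|a,z). -/
def VYaz (p : C → A → Z → Y → ℝ) (yv : Y → ℝ) (a : A) (z : Z) : ℝ :=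
  (∑ y, (yv y) ^ 2 * cYaz p a z y) - (EYaz p yv a z) ^ 2

/-- Conditional expectation E(Y|a,c). -/
def EYac (p : C → A → Z → Y → ℝ) (yv : Y → ℝ) (a : A) (c : C) : ℝ :=
  ∑ y, yv y * cYac p a c y

/-- Conditional expectation E(Y|z,c). -/
def EYzc (p : C → A → Z → Y → ℝ) (yv : Y → ℝ) (z : Z) (c : C) : ℝ :=
  ∑ y, yv y * cYzc p z c y

/-- Conditional variance var(Y|z,c). -/
def VYzc (p : C → A → Z → Y → ℝ) (yv : Y → ℝ) (z : Z) (c : C) : ℝ :=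
  (∑ y, (yv y) ^ 2 * cYzc p z c y) - (EYzc p yv z c) ^ 2

/-- var(C|a) for real-valued covariates. -/
def VCgivenA (p : C → A → Z → Y → ℝ) (cv : C → ℝ) (a : A) : ℝ :=
  (∑ c, (cv c) ^ 2 * (pAC p a c / pA p a)) - (∑ c, cv c * (pAC p a c / pA p a)) ^ 2

/-- var(Z|a) for real-valued mediators. -/
def VZgivenA (p : C → A → Z → Y → ℝ) (zv : Z → ℝ) (a : A) : ℝ :=
  (∑ z, (zv z) ^ 2 * cZA p z a) - (∑ z, zv z * cZA p z a) ^ 2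

/-- Expectation of f under p. -/
def Ep (p : C → A → Z → Y → ℝ) (f : C → A → Z → Y → ℝ) : ℝ :=
  ∑ c, ∑ a, ∑ z, ∑ y, p c a z y * f c a z y

/-- Variance of f under p. -/
def Varp (p : C → A → Z → Y → ℝ) (f : C → A → Z → Y → ℝ) : ℝ :=
  (∑ c, ∑ a, ∑ z, ∑ y, p c a z y * (f c a z y) ^ 2) - (Ep p f) ^ 2

/-- p is a strictly positive probability mass function. -/
def IsPMF (p : C → A → Z → Y → ℝ) : Prop :=
  (∀ c a z y, 0 < p c a z y) ∧ (∑ c, ∑ a, ∑ z, ∑ y, p c a z y) = 1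

/-- Y ⊥ A | (Z, C): p(y|a,z,c) does not depend on a. -/
def IndepYA (p : C → A → Z → Y → ℝ) : Prop :=
  ∀ a a' z c y, cY p a z c y = cY p a' z c y

/-- Z ⊥ C | A: p(z|a,c) = p(z|a) for all c. -/
def IndepZC (p : C → A → Z → Y → ℝ) : Prop :=
  ∀ z a c, cZ p z a c = cZA p z a

/-- θ_td. -/
def thTD (p : C → A → Z → Y → ℝ) (yv : Y → ℝ) (astar acirc : A) : ℝ :=
  ∑ z, ∑ c, ∑ ab, EYazc p yv ab z c * (cZ p z astar c - cZ p z acirc c) * cA p ab c * pC p c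

/-- The two-door efficient influence function φ_td. -/
def phiTD [DecidableEq A] (p : C → A → Z → Y → ℝ) (yv : Y → ℝ) (astar acirc : A)
    (c : C) (a : A) (z : Z) (y : Y) : ℝ :=
  (yv y - EYazc p yv a z c) * (cZ p z astar c - cZ p z acirc c) / cZ p z a c
  + ((∑ ab, EYazc p yv ab z c * cA p ab c)
      - ∑ ab, ∑ z', EYazc p yv ab z' c * cZ p z' a c * cA p ab c)
    * (ind a astar - ind a acirc) / cA p a c
  + (∑ z', EYazc p yv a z' c * (cZ p z' astar c - cZ p z' acirc c))
  - thTD p yv astar acirc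

/-- θ_bd. -/
def thBD (p : C → A → Z → Y → ℝ) (yv : Y → ℝ) (astar acirc : A) : ℝ :=
  ∑ c, pC p c * (EYac p yv astar c - EYac p yv acirc c)

/-- The back-door efficient influence function φ_bd. -/
def phiBD [DecidableEq A] (p : C → A → Z → Y → ℝ) (yv : Y → ℝ) (astar acirc : A)
    (c : C) (a : A) (_z : Z) (y : Y) : ℝ :=
  ind a astar * (yv y - EYac p yv astar c) / cA p astar c
  - ind a acirc * (yv y - EYac p yv acirc c) / cA p acirc c
  + EYac p yv astar c - EYac p yv acirc c - thBD p yv astar acirc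

/-- θ° (for the combined back-door/two-door model). -/
def thBDTD (p : C → A → Z → Y → ℝ) (yv : Y → ℝ) (astar acirc : A) : ℝ :=
  ∑ z, ∑ c, EYzc p yv z c * (cZ p z astar c - cZ p z acirc c) * pC p c

/-- The efficient influence function φ_bdtd. -/
def phiBDTD [DecidableEq A] (p : C → A → Z → Y → ℝ) (yv : Y → ℝ) (astar acirc : A)
    (c : C) (a : A) (z : Z) (y : Y) : ℝ :=
  (yv y - EYzc p yv z c) * (cZ p z astar c - cZ p z acirc c) / (∑ ab, cZ p z ab c * cA p ab c)
  + (EYzc p yv z c - ∑ z', EYzc p yv z' c * cZ p z' a c)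
    * (ind a astar - ind a acirc) / cA p a c
  + (∑ z', EYzc p yv z' c * (cZ p z' astar c - cZ p z' acirc c))
  - thBDTD p yv astar acirc

/-- ψ_fd(ă). -/
def psiFD (p : C → A → Z → Y → ℝ) (yv : Y → ℝ) (abreve : A) : ℝ :=
  ∑ z, ∑ ab, EYaz p yv ab z * pA p ab * cZA p z abreve

/-- θ_fd. -/
def thFD (p : C → A → Z → Y → ℝ) (yv : Y → ℝ) (astar acirc : A) : ℝ :=
  psiFD p yv astar - psiFD p yv acirc

/-- The front-door efficient influence function φ_fd. -/
def phiFD [DecidableEq A] (p : C → A → Z → Y → ℝ) (yv : Y → ℝ) (astar acirc : A)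
    (_c : C) (a : A) (z : Z) (y : Y) : ℝ :=
  (yv y - EYaz p yv a z) * (cZA p z astar - cZA p z acirc) / cZA p z a
  + ind a astar * ((∑ ab, EYaz p yv ab z * pA p ab) - psiFD p yv astar) / pA p astar
  - ind a acirc * ((∑ ab, EYaz p yv ab z * pA p ab) - psiFD p yv acirc) / pA p acirc
  + (∑ z', EYaz p yv a z' * (cZA p z' astar - cZA p z' acirc))
  - thFD p yv astar acirc

/-- θ' (for the combined front-door/two-door model). -/
def thFDTD (p : C → A → Z → Y → ℝ) (yv : Y → ℝ) (astar acirc : A) : ℝ :=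
  ∑ c, ∑ ab, ∑ z, EYazc p yv ab z c * (cZA p z astar - cZA p z acirc) * cA p ab c * pC p c

/-- The efficient influence function φ_fdtd. -/
def phiFDTD [DecidableEq A] (p : C → A → Z → Y → ℝ) (yv : Y → ℝ) (astar acirc : A)
    (c : C) (a : A) (z : Z) (y : Y) : ℝ :=
  (yv y - EYazc p yv a z c) * (cZA p z astar - cZA p z acirc) / cZA p z a
  + (∑ c', ((∑ ab, EYazc p yv ab z c' * cA p ab c')
        - ∑ ab, ∑ z', EYazc p yv ab z' c' * cZA p z' a * cA p ab c') * pC p c')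
    * (ind a astar - ind a acirc) / pA p a
  + (∑ z', EYazc p yv a z' c * (cZA p z' astar - cZA p z' acirc))
  - thFDTD p yv astar acirc

/-- θ'' (for the combined back/front/two-door model). -/
def thBDFDTD (p : C → A → Z → Y → ℝ) (yv : Y → ℝ) (astar acirc : A) : ℝ :=
  ∑ c, ∑ z, EYzc p yv z c * (cZA p z astar - cZA p z acirc) * pC p c

/-- The efficient influence function φ_bdfdtd. -/
def phiBDFDTD [DecidableEq A] (p : C → A → Z → Y → ℝ) (yv : Y → ℝ) (astar acirc : A)
    (c : C) (a : A) (z : Z) (y : Y) : ℝ :=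
  (yv y - EYzc p yv z c) * (cZA p z astar - cZA p z acirc) / (∑ ab, cA p ab c * cZA p z ab)
  + (∑ c', (EYzc p yv z c' - ∑ z', EYzc p yv z' c' * cZA p z' a) * pC p c')
    * (ind a astar - ind a acirc) / (∑ c', pC p c' * cA p a c')
  + (∑ z', EYzc p yv z' c * (cZA p z' astar - cZA p z' acirc))
  - thBDFDTD p yv astar acirc


section Marginals

variable {p : C → A → Z → Y → ℝ}

lemma pCAZ_pos [Nonempty Y] (hpos : ∀ c a z y, 0 < p c a z y) (c : C) (a : A) (z : Z) :
    0 < pCAZ p c a z :=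
  sum_pos (fun y _ => hpos c a z y) univ_nonempty

lemma pAC_pos [Nonempty Z] [Nonempty Y] (hpos : ∀ c a z y, 0 < p c a z y) (a : A) (c : C) :
    0 < pAC p a c :=
  sum_pos (fun z _ => pCAZ_pos hpos c a z) univ_nonempty

lemma pC_pos [Nonempty A] [Nonempty Z] [Nonempty Y] (hpos : ∀ c a z y, 0 < p c a z y) (c : C) :
    0 < pC p c :=
  sum_pos (fun a _ => pAC_pos hpos a c) univ_nonempty

lemma pZC_pos [Nonempty A] [Nonempty Y] (hpos : ∀ c a z y, 0 < p c a z y) (z : Z) (c : C) :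
    0 < pZC p z c :=
  sum_pos (fun a _ => pCAZ_pos hpos c a z) univ_nonempty

lemma sum_cA [Nonempty A] [Nonempty Z] [Nonempty Y] (hpos : ∀ c a z y, 0 < p c a z y) (c : C) :
    ∑ a, cA p a c = 1 := by
  simp only [cA, ← sum_div]
  exact div_self (pC_pos hpos c).ne'

lemma sum_cZ_mul_cA [Nonempty Z] [Nonempty Y] (hpos : ∀ c a z y, 0 < p c a z y) (z : Z) (c : C) :
    ∑ a, cZ p z a c * cA p a c = pZC p z c / pC p c := by
  rw [pZC, sum_div]
  refine sum_congr rfl fun a _ => ?_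
  have := (pAC_pos hpos a c).ne'
  rw [cZ, cA]
  field_simp

lemma sum_cYzc [Nonempty A] [Nonempty Y] (hpos : ∀ c a z y, 0 < p c a z y) (z : Z) (c : C) :
    ∑ y, cYzc p z c y = 1 := by
  simp only [cYzc, ← sum_div]
  rw [sum_comm]
  exact div_self (pZC_pos hpos z c).ne'

/-- Under `Y ⊥ A | (Z, C)` the joint law factors through `p(y|z,c)`. -/
lemma IndepYA.eq_pCAZ_mul_cYzc [Nonempty A] [Nonempty Y] (hind : IndepYA p)
    (hpos : ∀ c a z y, 0 < p c a z y) (c : C) (a : A) (z : Z) (y : Y) :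
    p c a z y = pCAZ p c a z * cYzc p z c y := by
  have hsum : ∑ a', p c a' z y = pZC p z c * cY p a z c y := by
    rw [pZC, sum_mul]
    refine sum_congr rfl fun a' _ => ?_
    rw [hind a a' z c y, cY, mul_div_cancel₀ _ (pCAZ_pos hpos c a' z).ne']
  rw [cYzc, hsum, mul_div_cancel_left₀ _ (pZC_pos hpos z c).ne', cY,
    mul_div_cancel₀ _ (pCAZ_pos hpos c a z).ne']

lemma IndepYA.EYazc_eq [Nonempty A] [Nonempty Y] (hind : IndepYA p)
    (hpos : ∀ c a z y, 0 < p c a z y) (yv : Y → ℝ) (a : A) (z : Z) (c : C) :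
    EYazc p yv a z c = EYzc p yv z c := by
  refine sum_congr rfl fun y _ => ?_
  rw [cY, hind.eq_pCAZ_mul_cYzc hpos, mul_div_cancel_left₀ _ (pCAZ_pos hpos c a z).ne']

lemma IndepYA.EYac_eq [Nonempty A] [Nonempty Y] (hind : IndepYA p)
    (hpos : ∀ c a z y, 0 < p c a z y) (yv : Y → ℝ) (a : A) (c : C) :
    EYac p yv a c = ∑ z, EYzc p yv z c * cZ p z a c := by
  simp only [EYac, cYac, EYzc, cZ, sum_mul, sum_div, mul_sum]
  rw [sum_comm]
  refine sum_congr rfl fun z _ => sum_congr rfl fun y _ => ?_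
  rw [hind.eq_pCAZ_mul_cYzc hpos]
  ring

lemma IndepYA.thTD_eq [Nonempty A] [Nonempty Z] [Nonempty Y] (hind : IndepYA p)
    (hpos : ∀ c a z y, 0 < p c a z y) (yv : Y → ℝ) (astar acirc : A) :
    thTD p yv astar acirc = thBDTD p yv astar acirc := by
  refine sum_congr rfl fun z _ => sum_congr rfl fun c _ => ?_
  simp only [hind.EYazc_eq hpos, ← sum_mul, ← mul_sum, sum_cA hpos, mul_one]

lemma IndepYA.thBD_eq [Nonempty A] [Nonempty Y] (hind : IndepYA p)
    (hpos : ∀ c a z y, 0 < p c a z y) (yv : Y → ℝ) (astar acirc : A) :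
    thBD p yv astar acirc = thBDTD p yv astar acirc := by
  rw [thBD, thBDTD, sum_comm]
  refine sum_congr rfl fun c _ => ?_
  rw [hind.EYac_eq hpos, hind.EYac_eq hpos, ← sum_sub_distrib, mul_sum]
  exact sum_congr rfl fun z _ => by ring

lemma pZC_mul_contrast [Nonempty A] [Nonempty Z] [Nonempty Y]
    (hpos : ∀ c a z y, 0 < p c a z y) (z : Z) (c : C) (w : ℝ) :
    pZC p z c * (w / (pZC p z c / pC p c)) = pC p c * w := by
  have := (pZC_pos hpos z c).ne'
  have := (pC_pos hpos c).ne'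
  field_simp

lemma sum_pCAZ_mul_div_cZ [Nonempty Z] [Nonempty Y] (hpos : ∀ c a z y, 0 < p c a z y)
    (z : Z) (c : C) (w : ℝ) :
    ∑ a, pCAZ p c a z * (w / cZ p z a c) = pC p c * w := by
  change _ = (∑ a, pAC p a c) * w
  rw [sum_mul]
  refine sum_congr rfl fun a _ => ?_
  have := (pAC_pos hpos a c).ne'
  have := (pCAZ_pos hpos c a z).ne'
  rw [cZ]
  field_simp

end Marginals

/-- Replacing the coefficient of the residual `Y - E(Y|z,c)` by its conditional mean given `(z,c)`
does not increase the variance. -/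
lemma Varp_residual_le [Nonempty A] [Nonempty Y] {p : C → A → Z → Y → ℝ}
    (hpos : ∀ c a z y, 0 < p c a z y) (hind : IndepYA p) (yv : Y → ℝ)
    {g₁ : C → Z → ℝ} {g₂ h : C → A → Z → ℝ}
    (hg : ∀ c z, ∑ a, pCAZ p c a z * g₂ c a z = pZC p z c * g₁ c z) :
    Varp p (fun c a z y => (yv y - EYzc p yv z c) * g₁ c z + h c a z)
      ≤ Varp p (fun c a z y => (yv y - EYzc p yv z c) * g₂ c a z + h c a z) := by
  set v : Z → C → ℝ := fun z c => ∑ y, (yv y - EYzc p yv z c) ^ 2 * cYzc p z c y with hv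
  have hv_nonneg : ∀ z c, 0 ≤ v z c := fun z c => sum_nonneg fun y _ =>
    mul_nonneg (sq_nonneg _) (div_nonneg (sum_nonneg fun a _ => (hpos c a z y).le)
      (pZC_pos hpos z c).le)
  have hres : ∀ z c, ∑ y, (yv y - EYzc p yv z c) * cYzc p z c y = 0 := fun z c => by
    simp only [sub_mul, sum_sub_distrib, ← mul_sum, sum_cYzc hpos, mul_one]
    exact sub_self _
  have hmean : ∀ g : C → A → Z → ℝ,
      Ep p (fun c a z y => (yv y - EYzc p yv z c) * g c a z + h c a z)
        = ∑ c, ∑ a, ∑ z, pCAZ p c a z * h c a z := fun g => by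
    refine sum_congr rfl fun c _ => sum_congr rfl fun a _ => sum_congr rfl fun z _ => ?_
    calc _ = ∑ y, (pCAZ p c a z * g c a z * ((yv y - EYzc p yv z c) * cYzc p z c y)
            + pCAZ p c a z * h c a z * cYzc p z c y) :=
          sum_congr rfl fun y _ => by rw [hind.eq_pCAZ_mul_cYzc hpos]; ring
      _ = _ := by
          rw [sum_add_distrib, ← mul_sum, ← mul_sum, hres, sum_cYzc hpos]; ring
  have hsq : ∀ g : C → A → Z → ℝ,
      ∑ c, ∑ a, ∑ z, ∑ y, p c a z y * ((yv y - EYzc p yv z c) * g c a z + h c a z) ^ 2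
        = ∑ c, ∑ z, ∑ a, pCAZ p c a z * (v z c * g c a z ^ 2 + h c a z ^ 2) := fun g => by
    refine sum_congr rfl fun c _ => ?_
    rw [sum_comm]
    refine sum_congr rfl fun z _ => sum_congr rfl fun a _ => ?_
    calc _ = ∑ y, (pCAZ p c a z * g c a z ^ 2 * ((yv y - EYzc p yv z c) ^ 2 * cYzc p z c y)
            + 2 * pCAZ p c a z * g c a z * h c a z * ((yv y - EYzc p yv z c) * cYzc p z c y)
            + pCAZ p c a z * h c a z ^ 2 * cYzc p z c y) :=
          sum_congr rfl fun y _ => by rw [hind.eq_pCAZ_mul_cYzc hpos]; ring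
      _ = _ := by
          rw [sum_add_distrib, sum_add_distrib, ← mul_sum, ← mul_sum, ← mul_sum, hres,
            sum_cYzc hpos]
          simp only [hv]
          ring
  rw [Varp, Varp, hmean (fun c _ z => g₁ c z), hmean g₂, hsq (fun c _ z => g₁ c z), hsq g₂]
  refine sub_le_sub_right (sum_le_sum fun c _ => sum_le_sum fun z _ => ?_) _
  have hcross : ∑ a, pCAZ p c a z * (v z c * (2 * g₁ c z * (g₂ c a z - g₁ c z))) = 0 := by
    calc _ = 2 * v z c * g₁ c z * (∑ a, pCAZ p c a z * g₂ c a z - (∑ a, pCAZ p c a z) * g₁ c z) := by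
          rw [sum_mul, ← sum_sub_distrib, mul_sum]
          exact sum_congr rfl fun a _ => by ring
      _ = 0 := by rw [hg, pZC, sub_self, mul_zero]
  rw [← add_zero (∑ a, pCAZ p c a z * (v z c * g₁ c z ^ 2 + h c a z ^ 2)), ← hcross,
    ← sum_add_distrib]
  refine sum_le_sum fun a _ => ?_
  have := mul_nonneg (mul_nonneg (pCAZ_pos hpos c a z).le (hv_nonneg z c))
    (sq_nonneg (g₂ c a z - g₁ c z))
  linarith

section InfluenceFunctions

variable [DecidableEq A]

/-- The part of the influence functions that does not involve the outcome, common to `phiBDTD`,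
`phiTD` and `phiBD` under `Y ⊥ A | (Z, C)`. -/
def mediatorPart (p : C → A → Z → Y → ℝ) (yv : Y → ℝ) (astar acirc : A) (c : C) (a : A) (z : Z) :
    ℝ :=
  (EYzc p yv z c - ∑ z', EYzc p yv z' c * cZ p z' a c) * (ind a astar - ind a acirc) / cA p a c
    + (∑ z', EYzc p yv z' c * (cZ p z' astar c - cZ p z' acirc c))
    - thBDTD p yv astar acirc

variable {p : C → A → Z → Y → ℝ}

lemma phiBDTD_eq [Nonempty Z] [Nonempty Y] (hpos : ∀ c a z y, 0 < p c a z y)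
    (yv : Y → ℝ) (astar acirc : A) :
    phiBDTD p yv astar acirc = fun c a z y =>
      (yv y - EYzc p yv z c) * ((cZ p z astar c - cZ p z acirc c) / (pZC p z c / pC p c))
        + mediatorPart p yv astar acirc c a z := by
  ext c a z y
  rw [phiBDTD, mediatorPart, sum_cZ_mul_cA hpos]
  ring

lemma IndepYA.phiTD_eq [Nonempty A] [Nonempty Z] [Nonempty Y] (hind : IndepYA p)
    (hpos : ∀ c a z y, 0 < p c a z y) (yv : Y → ℝ) (astar acirc : A) :
    phiTD p yv astar acirc = fun c a z y =>
      (yv y - EYzc p yv z c) * ((cZ p z astar c - cZ p z acirc c) / cZ p z a c)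
        + mediatorPart p yv astar acirc c a z := by
  ext c a z y
  simp only [phiTD, mediatorPart, hind.thTD_eq hpos, hind.EYazc_eq hpos, ← sum_mul, ← mul_sum,
    sum_cA hpos, mul_one]
  ring

lemma IndepYA.phiBD_eq [Nonempty A] [Nonempty Y] (hind : IndepYA p)
    (hpos : ∀ c a z y, 0 < p c a z y) (yv : Y → ℝ) (astar acirc : A) :
    phiBD p yv astar acirc = fun c a z y =>
      (yv y - EYzc p yv z c) * ((ind a astar - ind a acirc) / cA p a c)
        + mediatorPart p yv astar acirc c a z := by
  have hind_mul : ∀ (a b : A) (F : A → ℝ), ind a b * F b = ind a b * F a := fun a b F => by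
    by_cases hab : a = b
    · rw [hab]
    · simp [ind, hab]
  ext c a z y
  have hF : ∀ b, ind a b * (yv y - EYac p yv b c) / cA p b c
      = ind a b * (yv y - EYac p yv a c) / cA p a c := fun b => by
    simpa only [mul_div_assoc] using
      hind_mul a b fun b => (yv y - EYac p yv b c) / cA p b c
  rw [phiBD, hF, hF, hind.thBD_eq hpos, mediatorPart]
  simp only [hind.EYac_eq hpos, mul_sub, sum_sub_distrib]
  ring

lemma sum_pCAZ_mul_ind_div_cA [Nonempty A] [Nonempty Z] [Nonempty Y]
    (hpos : ∀ c a z y, 0 < p c a z y) (z : Z) (c : C) (astar acirc : A) :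
    ∑ a, pCAZ p c a z * ((ind a astar - ind a acirc) / cA p a c)
      = pC p c * (cZ p z astar c - cZ p z acirc c) := by
  have hterm : ∀ a, pCAZ p c a z * ((ind a astar - ind a acirc) / cA p a c)
      = ind a astar * (pC p c * cZ p z a c) - ind a acirc * (pC p c * cZ p z a c) := fun a => by
    have := (pAC_pos hpos a c).ne'
    have := (pC_pos hpos c).ne'
    rw [cZ, cA]
    field_simp
  rw [sum_congr rfl fun a _ => hterm a, sum_sub_distrib]
  simp only [ind, ite_mul, one_mul, zero_mul, sum_ite_eq', mem_univ, if_true]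
  ring

end InfluenceFunctions

/-- Proposition 3 (second part): φ_bdtd has variance no larger than φ_td and φ_bd. -/
theorem stmt7
    {C A Z Y : Type*} [Fintype C] [Fintype A] [Fintype Z] [Fintype Y]
    [Nonempty C] [Nonempty A] [Nonempty Z] [Nonempty Y] [DecidableEq A]
    (p : C → A → Z → Y → ℝ) (yv : Y → ℝ) (hyv : Function.Injective yv)
    (hp : IsPMF p) (astar acirc : A) (hne : astar ≠ acirc)
    (hind : IndepYA p) :
    Varp p (phiBDTD p yv astar acirc) ≤ Varp p (phiTD p yv astar acirc)
      ∧ Varp p (phiBDTD p yv astar acirc) ≤ Varp p (phiBD p yv astar acirc) := by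
  have hpos := hp.1
  rw [phiBDTD_eq hpos, hind.phiTD_eq hpos, hind.phiBD_eq hpos]
  refine ⟨Varp_residual_le hpos hind yv fun c z => ?_, Varp_residual_le hpos hind yv fun c z => ?_⟩
  · rw [sum_pCAZ_mul_div_cZ hpos, pZC_mul_contrast hpos]
  · rw [sum_pCAZ_mul_ind_div_cA hpos, pZC_mul_contrast hpos]

end TwoDoorPaper
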